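/- Let μ₊ and μ₋ be probability measures on a measurable space X, let π ∈ [0,1], let μ = π·μ₊ + (1−π)·μ₋, and let f : X → ℝ be measurable. Then for every trade-off parameter γ ∈ [0,1], the combined semi-supervised risk R_PNU(f) = (1−γ)·(R_PU(f) + R_NU(f) − 1/2) + γ·R_PN(f) equals R_PN(f). -/

import Mathlib

open MeasureTheory

/-- The zero-one pairwise loss `l01(u,v) = (1 - sign(u - v))/2`, with `sign 0 = 0`. -/
noncomputable def l01 (u v : ℝ) : ℝ := (1 - Real.sign (u - v)) / 2

lemma measurable_real_sign : Measurable Real.sign := by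
  have h : Real.sign = fun r : ℝ => if r < 0 then (-1 : ℝ) else if 0 < r then 1 else 0 := rfl
  rw [h]
  exact Measurable.ite measurableSet_Iio measurable_const
    (Measurable.ite measurableSet_Ioi measurable_const measurable_const)

lemma l01_add_swap (u v : ℝ) : l01 u v + l01 v u = 1 := by
  have h : Real.sign (v - u) = -Real.sign (u - v) := by rw [← Real.sign_neg, neg_sub]
  unfold l01
  rw [h]
  ring

lemma norm_l01_le_one (u v : ℝ) : ‖l01 u v‖ ≤ 1 := by
  unfold l01
  rcases Real.sign_apply_eq (u - v) with h | h | h <;> rw [h] <;> norm_num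

lemma measurable_l01_comp {X : Type*} [MeasurableSpace X] {f : X → ℝ} (hf : Measurable f) :
    Measurable fun p : X × X => l01 (f p.1) (f p.2) :=
  ((measurable_real_sign.comp
    ((hf.comp measurable_fst).sub (hf.comp measurable_snd))).const_sub 1).div_const 2

lemma integrable_l01_prod {X : Type*} [MeasurableSpace X] {f : X → ℝ} (hf : Measurable f)
    (μ ν : Measure X) [IsFiniteMeasure μ] [IsFiniteMeasure ν] :
    Integrable (fun p : X × X => l01 (f p.1) (f p.2)) (μ.prod ν) :=
  Integrable.of_bound (measurable_l01_comp hf).aestronglyMeasurable 1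
    (Filter.Eventually.of_forall fun _ => norm_l01_le_one _ _)

lemma integrable_l01_right {X : Type*} [MeasurableSpace X] {f : X → ℝ} (hf : Measurable f)
    (ν : Measure X) [IsFiniteMeasure ν] (x : X) :
    Integrable (fun x' => l01 (f x) (f x')) ν :=
  Integrable.of_bound
    ((measurable_l01_comp hf).comp measurable_prodMk_left).aestronglyMeasurable 1
    (Filter.Eventually.of_forall fun _ => norm_l01_le_one _ _)

/-- Ranking a distribution against itself has zero-one risk one half. -/
lemma integral_integral_l01_self {X : Type*} [MeasurableSpace X] {f : X → ℝ}
    (hf : Measurable f) (ν : Measure X) [IsProbabilityMeasure ν] :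
    ∫ x, ∫ x', l01 (f x) (f x') ∂ν ∂ν = 1 / 2 := by
  have hint := integrable_l01_prod hf ν ν
  have hswap : ∫ x, ∫ x', l01 (f x) (f x') ∂ν ∂ν = ∫ x, ∫ x', l01 (f x') (f x) ∂ν ∂ν :=
    integral_integral_swap hint
  have hcompl : ∫ x, ∫ x', l01 (f x') (f x) ∂ν ∂ν
      = 1 - ∫ x, ∫ x', l01 (f x) (f x') ∂ν ∂ν := by
    have h (x : X) : ∫ x', l01 (f x') (f x) ∂ν = 1 - ∫ x', l01 (f x) (f x') ∂ν := by
      simp_rw [fun x' => eq_sub_of_add_eq (l01_add_swap (f x') (f x))]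
      rw [integral_sub (integrable_const _) (integrable_l01_right hf ν x)]
      simp
    simp_rw [h]
    rw [integral_sub (integrable_const _) hint.integral_prod_left]
    simp
  linarith

/-- The integral against a convex combination of two measures. -/
lemma integral_ofReal_smul_add_ofReal_smul {X : Type*} [MeasurableSpace X] {μ ν : Measure X}
    {a b : ℝ} (ha : 0 ≤ a) (hb : 0 ≤ b) {g : X → ℝ} (hμ : Integrable g μ)
    (hν : Integrable g ν) :
    ∫ x, g x ∂(ENNReal.ofReal a • μ + ENNReal.ofReal b • ν)
      = a * ∫ x, g x ∂μ + b * ∫ x, g x ∂ν := by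
  rw [integral_add_measure (hμ.smul_measure ENNReal.ofReal_ne_top)
    (hν.smul_measure ENNReal.ofReal_ne_top), integral_smul_measure, integral_smul_measure,
    ENNReal.toReal_ofReal ha, ENNReal.toReal_ofReal hb, smul_eq_mul, smul_eq_mul]

/-- For every trade-off parameter `γ ∈ [0,1]`, the combined semi-supervised risk
`R_PNU(f) = (1 - γ)·(R_PU(f) + R_NU(f) - 1/2) + γ·R_PN(f)` equals `R_PN(f)`,
where the unlabeled marginal is `μ = π·μ₊ + (1 - π)·μ₋`. -/
theorem R_PNU_eq_R_PN {X : Type*} [MeasurableSpace X]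
    (μp μn μ : Measure X) [IsProbabilityMeasure μp] [IsProbabilityMeasure μn]
    (π : ℝ) (hπ0 : 0 ≤ π) (hπ1 : π ≤ 1)
    (hμ : μ = ENNReal.ofReal π • μp + ENNReal.ofReal (1 - π) • μn)
    (f : X → ℝ) (hf : Measurable f)
    (γ : ℝ) (hγ0 : 0 ≤ γ) (hγ1 : γ ≤ 1) :
    (1 - γ) * ((∫ x, ∫ x', l01 (f x) (f x') ∂μ ∂μp)
        + (∫ x, ∫ x', l01 (f x) (f x') ∂μn ∂μ) - 1 / 2)
      + γ * ∫ x, ∫ x', l01 (f x) (f x') ∂μn ∂μp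
      = ∫ x, ∫ x', l01 (f x) (f x') ∂μn ∂μp := by
  have hπ1' : 0 ≤ 1 - π := sub_nonneg.mpr hπ1
  have hpn := (integrable_l01_prod hf μp μn).integral_prod_left
  have hPU : ∫ x, ∫ x', l01 (f x) (f x') ∂μ ∂μp
      = π * (1 / 2) + (1 - π) * ∫ x, ∫ x', l01 (f x) (f x') ∂μn ∂μp := by
    simp_rw [hμ, fun x => integral_ofReal_smul_add_ofReal_smul hπ0 hπ1'
      (integrable_l01_right hf μp x) (integrable_l01_right hf μn x)]
    rw [integral_add ((integrable_l01_prod hf μp μp).integral_prod_left.const_mul π)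
      (hpn.const_mul (1 - π)), integral_const_mul, integral_const_mul,
      integral_integral_l01_self hf μp]
  have hNU : ∫ x, ∫ x', l01 (f x) (f x') ∂μn ∂μ
      = π * (∫ x, ∫ x', l01 (f x) (f x') ∂μn ∂μp) + (1 - π) * (1 / 2) := by
    rw [hμ, integral_ofReal_smul_add_ofReal_smul hπ0 hπ1' hpn
      (integrable_l01_prod hf μn μn).integral_prod_left, integral_integral_l01_self hf μn]
  rw [hPU, hNU]
  ring
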